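/- arXiv:2212.06652 — 10 statements merged into one kernel-verified Lean document; each statement's English description precedes it below -/
import Mathlib

section
/- Let U be a nonempty open subset of ℝ and let f : ℝ → ℝ be a function that is C^∞ on U (i.e., ContDiffOn ℝ ⊤ f U). Then there exist functions g, h : ℝ → ℝ, both C^∞ on all of ℝ, such that U ⊆ coz g and f(x)·g(x) = h(x) for every x ∈ U. -/
noncomputable section

/-- The cozero set of a function. -/
def coz (f : ℝ → ℝ) : Set ℝ := {x | f x ≠ 0}

/-- The derivatives up to order `n` of a compactly supported smooth function are
uniformly bounded by a common constant. -/
theorem exists_bound_iteratedFDeriv_of_hasCompactSupport {E F : Type*}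
    [NormedAddCommGroup E] [NormedSpace ℝ E] [NormedAddCommGroup F] [NormedSpace ℝ F]
    {f : E → F} (hf : ContDiff ℝ (⊤ : ℕ∞) f) (hc : HasCompactSupport f) (n : ℕ) :
    ∃ C : ℝ, 0 ≤ C ∧ ∀ k ≤ n, ∀ x, ‖iteratedFDeriv ℝ k f x‖ ≤ C := by
  have hb : ∀ k : ℕ, ∃ C : ℝ, ∀ x, ‖iteratedFDeriv ℝ k f x‖ ≤ C := fun k =>
    (hf.continuous_iteratedFDeriv (mod_cast le_top)).bounded_above_of_compact_support
      (hc.iteratedFDeriv k)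
  choose C hC using hb
  have hC0 : ∀ k, 0 ≤ C k := fun k => (norm_nonneg _).trans (hC k 0)
  refine ⟨∑ k ∈ Finset.range (n + 1), C k, Finset.sum_nonneg fun k _ => hC0 k, fun k hk x => ?_⟩
  exact (hC k x).trans (Finset.single_le_sum (fun i _ => hC0 i)
    (Finset.mem_range.2 (Nat.lt_succ_of_le hk)))

/-- If the derivatives of `f i` up to order `i` are bounded by `C i`, then any series
`∑ r i • f i` with `|r i| * C i ≤ 2⁻ⁱ` is smooth. -/
theorem contDiff_tsum_smul_of_bound {E F : Type*}
    [NormedAddCommGroup E] [NormedSpace ℝ E] [NormedAddCommGroup F] [NormedSpace ℝ F]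
    [CompleteSpace F] {f : ℕ → E → F} {C r : ℕ → ℝ}
    (hf : ∀ i, ContDiff ℝ (⊤ : ℕ∞) (f i))
    (hC : ∀ i, ∀ k ≤ i, ∀ x, ‖iteratedFDeriv ℝ k (f i) x‖ ≤ C i)
    (hr : ∀ i, |r i| * C i ≤ (1 / 2 : ℝ) ^ i) :
    ContDiff ℝ (⊤ : ℕ∞) fun x => ∑' i, r i • f i x := by
  refine contDiff_tsum_of_eventually (v := fun _ i => (1 / 2 : ℝ) ^ i)
    (fun i => contDiff_const.smul (hf i)) (fun _ _ => summable_geometric_two) fun k _ => ?_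
  rw [Nat.cofinite_eq_atTop]
  filter_upwards [Filter.eventually_ge_atTop k] with i hi x
  rw [iteratedFDeriv_const_smul_apply' ((hf i).of_le (mod_cast le_top)).contDiffAt, norm_smul,
    Real.norm_eq_abs]
  exact (mul_le_mul_of_nonneg_left (hC i k hi x) (abs_nonneg _)).trans (hr i)

/-- A nonempty open set is the union of the supports of countably many nonnegative bump functions,
each of which has compact topological support inside the set. -/
theorem exists_seq_contDiff_iUnion_support_eq {E : Type*} [NormedAddCommGroup E]
    [NormedSpace ℝ E] [FiniteDimensional ℝ E] {U : Set E} (hU : IsOpen U) (hne : U.Nonempty) :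
    ∃ φ : ℕ → E → ℝ, (∀ i, ContDiff ℝ (⊤ : ℕ∞) (φ i)) ∧ (∀ i, HasCompactSupport (φ i)) ∧
      (∀ i, tsupport (φ i) ⊆ U) ∧ (∀ i x, 0 ≤ φ i x) ∧ ∀ x ∈ U, ∃ i, φ i x ≠ 0 := by
  have hbump : ∀ x : U, ∃ φ : E → ℝ, tsupport φ ⊆ U ∧ HasCompactSupport φ ∧
      ContDiff ℝ (⊤ : ℕ∞) φ ∧ Set.range φ ⊆ Set.Icc 0 1 ∧ φ x = 1 := fun x =>
    exists_contDiff_tsupport_subset (hU.mem_nhds x.2)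
  choose φ hsub hcpt hsm hrange hone using hbump
  obtain ⟨T, hT, hTU⟩ := TopologicalSpace.isOpen_iUnion_countable
    (fun x : U => Function.support (φ x)) fun x => (hsm x).continuous.isOpen_support
  have hcover : ∀ y ∈ U, ∃ x ∈ T, φ x y ≠ 0 := by
    intro y hy
    have hmem : y ∈ ⋃ x : U, Function.support (φ x) :=
      Set.mem_iUnion.2 ⟨⟨y, hy⟩, by simp [hone ⟨y, hy⟩]⟩
    rw [← hTU] at hmem
    simpa using hmem
  have hTne : T.Nonempty := by
    obtain ⟨y, hy⟩ := hne
    obtain ⟨x, hx, -⟩ := hcover y hy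
    exact ⟨x, hx⟩
  obtain ⟨e, rfl⟩ := hT.exists_eq_range hTne
  refine ⟨fun i => φ (e i), fun i => hsm _, fun i => hcpt _, fun i => hsub _,
    fun i x => (hrange (e i) (Set.mem_range_self x)).1, fun x hx => ?_⟩
  obtain ⟨_, ⟨i, rfl⟩, hi⟩ := hcover x hx
  exact ⟨i, hi⟩

/-- The product of a smooth function whose topological support lies in an open set `U` with a
function smooth on `U` is smooth. -/
theorem contDiff_mul_of_tsupport_subset {E : Type*} [NormedAddCommGroup E] [NormedSpace ℝ E]
    {U : Set E} (hU : IsOpen U) {φ f : E → ℝ} {n : WithTop ℕ∞} (hφ : ContDiff ℝ n φ)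
    (hf : ContDiffOn ℝ n f U) (hsub : tsupport φ ⊆ U) : ContDiff ℝ n (φ * f) := by
  rw [contDiff_iff_contDiffAt]
  intro x
  by_cases hx : x ∈ tsupport φ
  · exact hφ.contDiffAt.mul (hf.contDiffAt (hU.mem_nhds (hsub hx)))
  · refine (contDiffAt_const (c := (0 : ℝ))).congr_of_eventuallyEq ?_
    filter_upwards [notMem_tsupport_iff_eventuallyEq.1 hx] with y hy
    simp [hy]

/-- For a nonempty open `U ⊆ ℝ` and `f` which is `C^∞` on `U`, there are
`g, h` which are `C^∞` on all of `ℝ` with `U ⊆ coz g` and `f * g = h` on `U`. -/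
theorem stmt0 (U : Set ℝ) (hU : IsOpen U) (hUne : U.Nonempty)
    (f : ℝ → ℝ) (hf : ContDiffOn ℝ (⊤ : ℕ∞) f U) :
    ∃ g h : ℝ → ℝ, ContDiff ℝ (⊤ : ℕ∞) g ∧ ContDiff ℝ (⊤ : ℕ∞) h ∧
      U ⊆ coz g ∧ ∀ x ∈ U, f x * g x = h x := by
  obtain ⟨φ, hsm, hcpt, hsub, hnn, hcover⟩ := exists_seq_contDiff_iUnion_support_eq hU hUne
  have hsm' : ∀ i, ContDiff ℝ (⊤ : ℕ∞) (φ i * f) := fun i =>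
    contDiff_mul_of_tsupport_subset hU (hsm i) hf (hsub i)
  choose C hC0 hC using fun i =>
    exists_bound_iteratedFDeriv_of_hasCompactSupport (hsm i) (hcpt i) i
  choose D hD0 hD using fun i =>
    exists_bound_iteratedFDeriv_of_hasCompactSupport (hsm' i) (hcpt i).mul_right i
  set r : ℕ → ℝ := fun i => (1 / 2 : ℝ) ^ i / (1 + C i + D i) with hr
  have hpos : ∀ i, 0 < 1 + C i + D i := fun i => by linarith [hC0 i, hD0 i]
  have hr0 : ∀ i, 0 < r i := fun i => div_pos (by positivity) (hpos i)
  have hrle : ∀ i, ∀ B ≤ 1 + C i + D i, |r i| * B ≤ (1 / 2 : ℝ) ^ i := by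
    intro i B hB
    rw [abs_of_pos (hr0 i)]
    calc r i * B ≤ r i * (1 + C i + D i) := mul_le_mul_of_nonneg_left hB (hr0 i).le
      _ = (1 / 2 : ℝ) ^ i := div_mul_cancel₀ _ (hpos i).ne'
  have hrC : ∀ i, |r i| * C i ≤ (1 / 2 : ℝ) ^ i := fun i => hrle i _ (by linarith [hD0 i])
  have hrD : ∀ i, |r i| * D i ≤ (1 / 2 : ℝ) ^ i := fun i => hrle i _ (by linarith [hC0 i])
  refine ⟨fun x => ∑' i, r i • φ i x, fun x => ∑' i, r i • (φ i * f) x,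
    contDiff_tsum_smul_of_bound hsm hC hrC, contDiff_tsum_smul_of_bound hsm' hD hrD, ?_, ?_⟩
  · intro x hx
    obtain ⟨i, hi⟩ := hcover x hx
    have hterm : ∀ j, 0 ≤ r j • φ j x := fun j => mul_nonneg (hr0 j).le (hnn j x)
    have hsum : Summable fun j => r j • φ j x := by
      refine Summable.of_nonneg_of_le hterm (fun j => ?_) summable_geometric_two
      have hle : φ j x ≤ C j := by
        simpa [abs_of_nonneg (hnn j x)] using hC j 0 (Nat.zero_le j) x
      calc r j • φ j x ≤ |r j| * C j :=
            mul_le_mul (le_abs_self _) hle (hnn j x) (abs_nonneg _)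
        _ ≤ (1 / 2 : ℝ) ^ j := hrC j
    exact (hsum.tsum_pos hterm i (mul_pos (hr0 i) ((hnn i x).lt_of_ne' hi))).ne'
  · intro x _
    rw [← tsum_mul_left]
    refine tsum_congr fun i => ?_
    simp only [smul_eq_mul, Pi.mul_apply]
    ring
end
end

section
/- Let k ∈ ℕ, let U be a nonempty open subset of ℝ, and let f : ℝ → ℝ be C^k on U (i.e., ContDiffOn ℝ k f U). Then there exist a function g : ℝ → ℝ that is C^∞ on ℝ with U ⊆ coz g, and a function h : ℝ → ℝ that is C^k on ℝ, such that f(x)·g(x) = h(x) for every x ∈ U. -/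
noncomputable section

section

open Set Function Filter Topology
open scoped ContDiff

variable {E : Type*} [NormedAddCommGroup E] [NormedSpace ℝ E]

/-- A `C^n` function on an open set times a `C^n` function whose topological support lies in
that set is `C^n` everywhere. -/
theorem ContDiffOn.mul_contDiff_of_tsupport_subset {n : ℕ∞ω} {s : Set E} {f φ : E → ℝ}
    (hf : ContDiffOn ℝ n f s) (hs : IsOpen s) (hφ : ContDiff ℝ n φ) (hsupp : tsupport φ ⊆ s) :
    ContDiff ℝ n (fun x => f x * φ x) := by
  refine contDiff_iff_contDiffAt.2 fun x => ?_
  by_cases hx : x ∈ s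
  · exact (hf.contDiffAt (hs.mem_nhds hx)).mul hφ.contDiffAt
  · have hx0 : φ =ᶠ[𝓝 x] 0 := notMem_tsupport_iff_eventuallyEq.1 fun h => hx (hsupp h)
    refine (contDiffAt_const (c := (0 : ℝ))).congr_of_eventuallyEq ?_
    filter_upwards [hx0] with y hy
    simp [hy]

/-- The derivatives of a compactly supported `C^N` function, up to any finite order at most `N`,
are uniformly bounded. -/
theorem ContDiff.exists_norm_iteratedFDeriv_le_of_hasCompactSupport {N : ℕ∞} {φ : E → ℝ}
    (hφ : ContDiff ℝ N φ) (hc : HasCompactSupport φ) (n : ℕ) :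
    ∃ M : ℝ, 0 < M ∧ ∀ i ≤ n, (i : ℕ∞) ≤ N → ∀ x, ‖iteratedFDeriv ℝ i φ x‖ ≤ M := by
  have bound (i : ℕ) : ∃ R : ℝ, 0 ≤ R ∧ ((i : ℕ∞) ≤ N → ∀ x, ‖iteratedFDeriv ℝ i φ x‖ ≤ R) := by
    by_cases hi : (i : ℕ∞) ≤ N
    · obtain ⟨R, hR⟩ :=
        (hφ.continuous_iteratedFDeriv (mod_cast hi)).norm.bddAbove_range_of_hasCompactSupport
          ((hc.iteratedFDeriv (𝕜 := ℝ) i).comp_left norm_zero)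
      exact ⟨max R 0, le_max_right _ _,
        fun _ x => (hR (mem_range_self x)).trans (le_max_left _ _)⟩
    · exact ⟨0, le_rfl, fun h => absurd h hi⟩
  choose R hR0 hR using bound
  refine ⟨∑ i ∈ Finset.range (n + 1), R i + 1, ?_, fun i hi hiN x => ?_⟩
  · have := Finset.sum_nonneg fun i (_ : i ∈ Finset.range (n + 1)) => hR0 i
    linarith
  · have := Finset.single_le_sum (fun j _ => hR0 j) (Finset.mem_range_succ_iff.2 hi)
    linarith [hR i hiN x]

theorem norm_iteratedFDeriv_const_mul_le {N : ℕ∞} {φ : E → ℝ} (hφ : ContDiff ℝ N φ) {i : ℕ}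
    (hi : (i : ℕ∞) ≤ N) {r M δ : ℝ} (hr : 0 ≤ r) (hrM : r * M ≤ δ) {x : E}
    (hM : ‖iteratedFDeriv ℝ i φ x‖ ≤ M) :
    ‖iteratedFDeriv ℝ i (fun y => r * φ y) x‖ ≤ δ := by
  have h : iteratedFDeriv ℝ i (fun y => r * φ y) x = r • iteratedFDeriv ℝ i φ x :=
    iteratedFDeriv_const_smul_apply (a := r) (hφ.contDiffAt.of_le (mod_cast hi))
  rw [h, norm_smul, Real.norm_of_nonneg hr]
  exact (mul_le_mul_of_nonneg_left hM hr).trans hrM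

/-- A series of `C^N` functions whose `n`-th term has derivatives of order at most `n` bounded
by `2⁻ⁿ` is `C^N`. -/
theorem contDiff_tsum_of_norm_iteratedFDeriv_le_geometric {N : ℕ∞} {φ : ℕ → E → ℝ}
    (hφ : ∀ n, ContDiff ℝ N (φ n))
    (hb : ∀ n i : ℕ, i ≤ n → (i : ℕ∞) ≤ N → ∀ x, ‖iteratedFDeriv ℝ i (φ n) x‖ ≤ (1 / 2 : ℝ) ^ n) :
    ContDiff ℝ N fun x => ∑' n, φ n x := by
  refine contDiff_tsum_of_eventually hφ (fun _ _ => summable_geometric_two) fun i hi => ?_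
  rw [Nat.cofinite_eq_atTop]
  filter_upwards [eventually_ge_atTop i] with n hn x
  exact hb n i hn hi x

variable [FiniteDimensional ℝ E]

/-- A nonempty open set is covered by the supports of a sequence of nonnegative smooth functions,
each compactly supported in that set. -/
theorem IsOpen.exists_seq_contDiff_tsupport_subset {s : Set E} (hs : IsOpen s)
    (hne : s.Nonempty) :
    ∃ φ : ℕ → E → ℝ, (∀ n, tsupport (φ n) ⊆ s) ∧ (∀ n, HasCompactSupport (φ n)) ∧
      (∀ n, ContDiff ℝ ∞ (φ n)) ∧ (∀ n x, 0 ≤ φ n x) ∧ ∀ x ∈ s, ∃ n, φ n x ≠ 0 := by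
  have bump (x : s) := exists_contDiff_tsupport_subset (n := ⊤) (hs.mem_nhds x.2)
  choose ψ hsupp hcomp hsmooth hrange hone using bump
  have : Nonempty s := hne.to_subtype
  obtain ⟨t, htc, ht⟩ := TopologicalSpace.countable_cover_nhds (f := fun x : s =>
    {y : s | ψ x y ≠ 0}) fun x =>
      (((hsmooth x).continuous.comp continuous_subtype_val).isOpen_support).mem_nhds
        (by simp [hone])
  have htne : t.Nonempty := by
    by_contra! h
    simp only [h, mem_empty_iff_false, iUnion_of_empty, iUnion_empty] at ht
    exact empty_ne_univ ht
  obtain ⟨e, rfl⟩ := htc.exists_eq_range htne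
  refine ⟨fun n => ψ (e n), fun n => hsupp _, fun n => hcomp _, fun n => hsmooth _,
    fun n x => (hrange _ (mem_range_self x)).1, fun x hx => ?_⟩
  have hmem : (⟨x, hx⟩ : s) ∈ ⋃ y ∈ range e, {z : s | ψ y z ≠ 0} := ht ▸ mem_univ _
  simpa using hmem

/-- A `C^k` function on a nonempty open set becomes the restriction of a globally `C^k` function
after multiplication by a suitable smooth function that is positive on the open set. -/
theorem ContDiffOn.exists_contDiff_pos_mul {k : ℕ∞} {s : Set E} {f : E → ℝ}
    (hf : ContDiffOn ℝ k f s) (hs : IsOpen s) (hne : s.Nonempty) :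
    ∃ g : E → ℝ, ContDiff ℝ ∞ g ∧ ContDiff ℝ k (fun x => f x * g x) ∧ ∀ x ∈ s, 0 < g x := by
  obtain ⟨φ, hsupp, hcomp, hsmooth, hnonneg, hcover⟩ :=
    hs.exists_seq_contDiff_tsupport_subset hne
  have hfφ (n : ℕ) : ContDiff ℝ k (fun x => f x * φ n x) :=
    hf.mul_contDiff_of_tsupport_subset hs ((hsmooth n).of_le (mod_cast le_top)) (hsupp n)
  choose A hA0 hA using fun n =>
    (hsmooth n).exists_norm_iteratedFDeriv_le_of_hasCompactSupport (hcomp n) n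
  choose B hB0 hB using fun n =>
    (hfφ n).exists_norm_iteratedFDeriv_le_of_hasCompactSupport ((hcomp n).mul_left) n
  let r : ℕ → ℝ := fun n => (1 / 2) ^ n / (A n + B n)
  have hr (n : ℕ) : 0 < r n := div_pos (by positivity) (add_pos (hA0 n) (hB0 n))
  have hrAB (n : ℕ) : r n * A n + r n * B n = (1 / 2) ^ n := by
    rw [← mul_add]
    exact div_mul_cancel₀ _ (add_pos (hA0 n) (hB0 n)).ne'
  have hrA (n : ℕ) : r n * A n ≤ (1 / 2) ^ n := by
    linarith [hrAB n, mul_pos (hr n) (hB0 n)]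
  have hrB (n : ℕ) : r n * B n ≤ (1 / 2) ^ n := by
    linarith [hrAB n, mul_pos (hr n) (hA0 n)]
  have hg (n i : ℕ) (hi : i ≤ n) (hiN : (i : ℕ∞) ≤ ⊤) (x : E) :
      ‖iteratedFDeriv ℝ i (fun y => r n * φ n y) x‖ ≤ (1 / 2 : ℝ) ^ n :=
    norm_iteratedFDeriv_const_mul_le (hsmooth n) hiN (hr n).le (hrA n) (hA n i hi hiN x)
  refine ⟨fun x => ∑' n, r n * φ n x, ?_, ?_, fun x hx => ?_⟩
  · exact contDiff_tsum_of_norm_iteratedFDeriv_le_geometric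
      (fun n => contDiff_const.mul (hsmooth n)) hg
  · simp_rw [← tsum_mul_left, mul_left_comm (f _)]
    exact contDiff_tsum_of_norm_iteratedFDeriv_le_geometric
      (fun n => contDiff_const.mul (hfφ n)) fun n i hi hiN x =>
        norm_iteratedFDeriv_const_mul_le (hfφ n) hiN (hr n).le (hrB n) (hB n i hi hiN x)
  · have hsum : Summable fun n => r n * φ n x :=
      .of_norm_bounded summable_geometric_two fun n => by
        simpa only [norm_iteratedFDeriv_zero] using hg n 0 (Nat.zero_le n) le_top x
    obtain ⟨n, hn⟩ := hcover x hx
    exact hsum.tsum_pos (fun i => mul_nonneg (hr i).le (hnonneg i x)) n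
      (mul_pos (hr n) ((hnonneg n x).lt_of_ne' hn))

end

/-- For `k ∈ ℕ`, a nonempty open `U ⊆ ℝ` and `f` which is `C^k` on `U`, there are
`g` which is `C^∞` on `ℝ` with `U ⊆ coz g` and `h` which is `C^k` on `ℝ`
such that `f * g = h` on `U`. -/
theorem stmt2 (k : ℕ) (U : Set ℝ) (hU : IsOpen U) (hUne : U.Nonempty)
    (f : ℝ → ℝ) (hf : ContDiffOn ℝ k f U) :
    ∃ g h : ℝ → ℝ, ContDiff ℝ (⊤ : ℕ∞) g ∧ ContDiff ℝ k h ∧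
      U ⊆ coz g ∧ ∀ x ∈ U, f x * g x = h x := by
  obtain ⟨g, hg, hfg, hpos⟩ := ContDiffOn.exists_contDiff_pos_mul (k := (k : ℕ∞)) hf hU hUne
  exact ⟨g, fun x => f x * g x, hg, hfg, fun x hx => (hpos x hx).ne', fun _ _ => rfl⟩
end
end

section
/- Fix k ∈ ℕ ∪ {∞}. The ring C^k(ℝ) is complemented: for every b : ℝ → ℝ that is C^k on ℝ there exists a : ℝ → ℝ, C^k on ℝ, such that a(x)·b(x) = 0 for all x ∈ ℝ and the cozero set of a + b is dense in ℝ (so that a + b is a non-zero-divisor in C^k(ℝ)). -/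
noncomputable section

/-- The ring `C^k(ℝ)` is complemented: for every `C^k` function `b` there is a
`C^k` function `a` with `a * b = 0` pointwise and `coz (a + b)` dense (so `a + b`
is a non-zero-divisor in `C^k(ℝ)`). -/
theorem stmt5 (k : ℕ∞) (b : ℝ → ℝ) (hb : ContDiff ℝ k b) :
    ∃ a : ℝ → ℝ, ContDiff ℝ k a ∧ (∀ x, a x * b x = 0) ∧
      Dense (coz (fun x => a x + b x)) := by
  obtain ⟨a, a_supp, a_diff, -⟩ :=
    (isClosed_closure (s := Function.support b)).isOpen_compl.exists_contDiff_support_eq (n := k)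
  have a_ne : ∀ x, a x ≠ 0 ↔ x ∉ closure (Function.support b) := fun x => by
    rw [← Function.mem_support, a_supp, Set.mem_compl_iff]
  have a_zero : ∀ x, b x ≠ 0 → a x = 0 := fun x hx =>
    not_not.1 fun h => (a_ne x).1 h (subset_closure hx)
  refine ⟨a, a_diff, fun x => ?_, fun x => ?_⟩
  · by_cases hx : b x = 0
    · rw [hx, mul_zero]
    · rw [a_zero x hx, zero_mul]
  · by_cases hx : x ∈ closure (Function.support b)
    · refine closure_mono (fun y hy => ?_) hx
      change a y + b y ≠ 0
      rwa [a_zero y hy, zero_add]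
    · refine subset_closure ?_
      change a x + b x ≠ 0
      have hbx : b x = 0 := not_not.1 fun h => hx (subset_closure h)
      rw [hbx, add_zero]
      exact (a_ne x).2 hx
end
end

section
/- Fix k ∈ ℕ ∪ {∞}. If g : ℝ → ℝ is C^k on ℝ and g is a non-zero-divisor in the ring C^k(ℝ), then g is also a non-zero-divisor in the ring C(ℝ) of all continuous real-valued functions on ℝ: whenever f : ℝ → ℝ is continuous and f(x)·g(x) = 0 for all x, then f is identically zero. -/
noncomputable section

/-- A non-zero-divisor of `C^k(ℝ)` is also a non-zero-divisor in the larger ring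
`C(ℝ)` of continuous functions. -/
theorem stmt6 (k : ℕ∞) (g : ℝ → ℝ) (hg : ContDiff ℝ k g)
    (hnzd : ∀ f : ℝ → ℝ, ContDiff ℝ k f → (∀ x, f x * g x = 0) → f = 0) :
    ∀ f : ℝ → ℝ, Continuous f → (∀ x, f x * g x = 0) → f = 0 := by
  intro f hf hfg
  obtain ⟨h, hsupp, hh, -⟩ := hf.isOpen_support.exists_contDiff_support_eq (n := k)
  have hzero : ∀ x, h x = 0 ↔ f x = 0 := fun x => by
    simpa only [Function.mem_support, not_not] using not_congr (Set.ext_iff.mp hsupp x)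
  have hmul : ∀ x, h x * g x = 0 := fun x => by
    simpa only [mul_eq_zero, hzero] using hfg x
  funext x
  exact (hzero x).mp (congrFun (hnzd h hh hmul) x)
end
end

section
/- Fix k ∈ ℕ ∪ {∞} and let R = C^k(ℝ). The classical ring of quotients of R, i.e., the localization Q = FractionRing R of R at its submonoid of non-zero-divisors, is von Neumann regular: for every q ∈ Q there exists t ∈ Q with q·t·q = q. -/
noncomputable section

/-- The ring `C^k(ℝ)` of `k`-times continuously differentiable functions `ℝ → ℝ`,
as a subring of the ring of all functions `ℝ → ℝ` with pointwise operations. -/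
def Ck (k : ℕ∞) : Subring (ℝ → ℝ) where
  carrier := {f | ContDiff ℝ k f}
  one_mem' := show ContDiff ℝ k (fun _ => (1 : ℝ)) from contDiff_const
  mul_mem' := fun {a b} ha hb => show ContDiff ℝ k (a * b) from ContDiff.mul ha hb
  zero_mem' := show ContDiff ℝ k (fun _ => (0 : ℝ)) from contDiff_const
  add_mem' := fun {a b} ha hb => show ContDiff ℝ k (a + b) from ContDiff.add ha hb
  neg_mem' := fun {a} ha => show ContDiff ℝ k (-a) from ContDiff.neg ha

/-- A function `f : U → ℝ` on an open set `U ⊆ ℝ` is `C^k` if some (equivalently,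
since `ContDiffOn` only depends on values on `U`, any) extension of it to `ℝ`
is `ContDiffOn ℝ k` on `U`. -/
def IsCkOn (k : ℕ∞) (U : Set ℝ) (f : ↥U → ℝ) : Prop :=
  ∃ F : ℝ → ℝ, ContDiffOn ℝ k F U ∧ ∀ x : U, F x = f x

/-- The ring `C^k(U)` of `k`-times continuously differentiable functions `U → ℝ`,
as a subring of the ring of all functions `↥U → ℝ` with pointwise operations. -/
def CkOn (k : ℕ∞) (U : Set ℝ) : Subring (↥U → ℝ) where
  carrier := {f | IsCkOn k U f}
  one_mem' := ⟨fun _ => 1, contDiffOn_const, fun _ => rfl⟩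
  mul_mem' := fun {a b} ha hb => by
    obtain ⟨F, hF, hFa⟩ := ha; obtain ⟨G, hG, hGb⟩ := hb
    exact ⟨F * G, hF.mul hG, fun x => by
      simp only [Pi.mul_apply, hFa x, hGb x]⟩
  zero_mem' := ⟨fun _ => 0, contDiffOn_const, fun _ => rfl⟩
  add_mem' := fun {a b} ha hb => by
    obtain ⟨F, hF, hFa⟩ := ha; obtain ⟨G, hG, hGb⟩ := hb
    exact ⟨F + G, hF.add hG, fun x => by
      simp only [Pi.add_apply, hFa x, hGb x]⟩
  neg_mem' := fun {a} ha => by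
    obtain ⟨F, hF, hFa⟩ := ha
    exact ⟨-F, hF.neg, fun x => by simp only [Pi.neg_apply, hFa x]⟩

/-- The restriction ring homomorphism `ψ : C^k(ℝ) → C^k(U)`. -/
def restrictHom (k : ℕ∞) (U : Set ℝ) : Ck k →+* CkOn k U where
  toFun f := ⟨fun x => f.1 x, f.1, ContDiff.contDiffOn f.2, fun _ => rfl⟩
  map_one' := rfl
  map_mul' _ _ := rfl
  map_zero' := rfl
  map_add' _ _ := rfl

instance algebraCkOn (k : ℕ∞) (U : Set ℝ) : Algebra (Ck k) (CkOn k U) :=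
  (restrictHom k U).toAlgebra

/-- The multiplicatively closed subset `M = {a ∈ C^k(ℝ) | U ⊆ coz a}`. -/
def cozSubmonoid (k : ℕ∞) (U : Set ℝ) : Submonoid (Ck k) where
  carrier := {a | U ⊆ coz a.1}
  one_mem' := fun _ _ => one_ne_zero
  mul_mem' := fun {a b} ha hb x hx =>
    show a.1 x * b.1 x ≠ 0 from mul_ne_zero (ha hx) (hb hx)

/-- An element of `C^k(ℝ)` whose cozero set is dense is a non-zero-divisor. -/
theorem mem_nonZeroDivisors_of_dense_coz {k : ℕ∞} {u : Ck k} (hu : Dense (coz u.1)) :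
    u ∈ nonZeroDivisors (Ck k) := by
  rw [mem_nonZeroDivisors_iff_right]
  intro f hf
  have hfc : Continuous f.1 := ContDiff.continuous (show ContDiff ℝ k f.1 from f.2)
  refine Subtype.ext (hfc.ext_on hu continuous_const fun x hx => ?_)
  have h : f.1 x * u.1 x = 0 := congrFun (congrArg Subtype.val hf) x
  exact (mul_eq_zero.mp h).resolve_right hx

/-- Every `a ∈ C^k(ℝ)` has an annihilating complement: some `b` with `a * b = 0` and `a + b`
a non-zero-divisor. -/
theorem exists_mul_eq_zero_and_add_mem_nonZeroDivisors {k : ℕ∞} (a : Ck k) :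
    ∃ b : Ck k, a * b = 0 ∧ a + b ∈ nonZeroDivisors (Ck k) := by
  obtain ⟨g, hg, hgc, -⟩ := IsOpen.exists_contDiff_support_eq (n := k)
    (isOpen_interior (s := {x : ℝ | a.1 x = 0}))
  have hab (x : ℝ) (hx : a.1 x ≠ 0) : g x = 0 := by
    by_contra h
    have hmem : x ∈ Function.support g := h
    rw [hg] at hmem
    exact hx (interior_subset hmem : x ∈ {x : ℝ | a.1 x = 0})
  refine ⟨⟨g, hgc⟩, Subtype.ext (funext fun x => ?_), mem_nonZeroDivisors_of_dense_coz ?_⟩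
  · by_cases hx : a.1 x = 0
    · exact mul_eq_zero_of_left hx _
    · exact mul_eq_zero_of_right _ (hab x hx)
  · rw [← compl_compl (coz _), ← interior_eq_empty_iff_dense_compl,
      Set.eq_empty_iff_forall_notMem]
    intro x hx
    have hzero (y : ℝ) (hy : y ∈ (coz (a + ⟨g, hgc⟩ : Ck k).1)ᶜ) : a.1 y = 0 ∧ g y = 0 := by
      have hsum : a.1 y + g y = 0 := not_not.mp hy
      have ha : a.1 y = 0 := by
        by_contra h
        rw [hab y h, add_zero] at hsum
        exact h hsum
      exact ⟨ha, by rwa [ha, zero_add] at hsum⟩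
    have hmem : x ∈ interior {x : ℝ | a.1 x = 0} :=
      interior_mono (fun y hy => (hzero y hy).1) hx
    rw [← hg] at hmem
    exact hmem (hzero x (interior_subset hx)).2

/-- The classical ring of quotients of `C^k(ℝ)` (its localization at the
non-zero-divisors) is von Neumann regular. -/
theorem stmt10 (k : ℕ∞) :
    ∀ q : FractionRing (Ck k), ∃ t : FractionRing (Ck k), q * t * q = q := by
  intro q
  obtain ⟨a, s, rfl⟩ := IsLocalization.exists_mk'_eq (nonZeroDivisors (Ck k)) q
  obtain ⟨b, hab, hu⟩ := exists_mul_eq_zero_and_add_mem_nonZeroDivisors a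
  refine ⟨IsLocalization.mk' _ (s : Ck k) ⟨a + b, hu⟩, ?_⟩
  rw [← IsLocalization.mk'_mul, ← IsLocalization.mk'_mul, IsLocalization.mk'_eq_iff_eq]
  congr 1
  simp only [Submonoid.coe_mul]
  linear_combination (-(s : Ck k) * s) * hab
end
end

section
/- Fix k ∈ ℕ ∪ {∞} and let R = C^k(ℝ). The classical ring of quotients Q = FractionRing R (the localization of R at its non-zero-divisors) is self-injective: Q is injective as a module over itself. -/
noncomputable section

open Set Filter Topology
open scoped NNReal nonZeroDivisors

/-- A sequence of compactly supported `C^k` functions can be rescaled by positive constants so that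
its sum converges to a `C^k` function. -/
theorem exists_pos_contDiff_tsum_smul {E F : Type*} [NormedAddCommGroup E] [NormedSpace ℝ E]
    [NormedAddCommGroup F] [NormedSpace ℝ F] [CompleteSpace F] {k : ℕ∞} {u : ℕ → E → F}
    (hu : ∀ n, ContDiff ℝ k (u n)) (hc : ∀ n, HasCompactSupport (u n)) :
    ∃ r : ℕ → ℝ, (∀ n, 0 < r n) ∧ ContDiff ℝ k (fun x => ∑' n, r n • u n x) ∧
      ∀ x, Summable fun n => r n • u n x := by
  obtain ⟨δ, δpos, c, δc, -⟩ := NNReal.exists_pos_sum_of_countable one_ne_zero ℕ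
  have hδ : Summable fun n => (δ n : ℝ) := (NNReal.hasSum_coe.2 δc).summable
  have bound : ∀ n i : ℕ, ∃ R : ℝ, 0 ≤ R ∧
      ((i : ℕ∞) ≤ k → ∀ x, ‖iteratedFDeriv ℝ i (u n) x‖ ≤ R) := by
    intro n i
    by_cases hi : (i : ℕ∞) ≤ k
    · obtain ⟨R, hR⟩ : BddAbove (range fun x => ‖iteratedFDeriv ℝ i (u n) x‖) := by
        apply ((hu n).continuous_iteratedFDeriv
          (mod_cast hi)).norm.bddAbove_range_of_hasCompactSupport
        exact ((hc n).iteratedFDeriv i).comp_left norm_zero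
      exact ⟨max R 0, le_max_right _ _, fun _ x => (hR (mem_range_self x)).trans (le_max_left _ _)⟩
    · exact ⟨0, le_rfl, fun h => absurd h hi⟩
  choose R R_nonneg hR using bound
  let M : ℕ → ℝ := fun n => 1 + ∑ i ∈ Finset.range (n + 1), R n i
  have Mpos : ∀ n, 0 < M n := fun n =>
    add_pos_of_pos_of_nonneg one_pos (Finset.sum_nonneg fun i _ => R_nonneg n i)
  have hRM : ∀ n, ∀ i ≤ n, R n i ≤ M n := fun n i hi => by
    have := Finset.single_le_sum (f := R n) (fun i _ => R_nonneg n i)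
      (Finset.mem_range.2 (Nat.lt_succ_of_le hi))
    exact this.trans (by simp [M])
  have rpos : ∀ n, 0 < (M n)⁻¹ * δ n := fun n =>
    mul_pos (inv_pos.2 (Mpos n)) (NNReal.coe_pos.2 (δpos n))
  have hr : ∀ n i : ℕ, i ≤ n → (i : ℕ∞) ≤ k → ∀ x,
      ‖iteratedFDeriv ℝ i (((M n)⁻¹ * δ n) • u n) x‖ ≤ δ n := by
    intro n i hi hik x
    rw [iteratedFDeriv_const_smul_apply ((hu n).contDiffAt.of_le (mod_cast hik)), norm_smul,
      Real.norm_of_nonneg (rpos n).le]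
    calc (M n)⁻¹ * δ n * ‖iteratedFDeriv ℝ i (u n) x‖
        ≤ (M n)⁻¹ * δ n * M n :=
          mul_le_mul_of_nonneg_left ((hR n i hik x).trans (hRM n i hi)) (rpos n).le
      _ = δ n := by have := (Mpos n).ne'; field_simp
  refine ⟨fun n => (M n)⁻¹ * δ n, rpos, ?_, fun x => ?_⟩
  · refine contDiff_tsum_of_eventually (f := fun n => ((M n)⁻¹ * δ n) • u n)
      (v := fun _ n => (δ n : ℝ)) (fun n => (hu n).const_smul _) (fun _ _ => hδ) fun i hi => ?_
    rw [Nat.cofinite_eq_atTop]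
    filter_upwards [eventually_ge_atTop i] with n hn
    exact hr n i hn (mod_cast hi)
  · refine Summable.of_norm_bounded hδ fun n => ?_
    simpa only [norm_iteratedFDeriv_zero] using! hr n 0 n.zero_le (by simp) x

/-- An open set is covered by the cozero sets of a sequence of nonnegative smooth functions which
are compactly supported inside it. -/
theorem IsOpen.exists_seq_contDiff_cover {E : Type*} [NormedAddCommGroup E] [NormedSpace ℝ E]
    [FiniteDimensional ℝ E] (k : ℕ∞) {V : Set E} (hV : IsOpen V) :
    ∃ φ : ℕ → E → ℝ, (∀ n, ContDiff ℝ k (φ n)) ∧ (∀ n, HasCompactSupport (φ n)) ∧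
      (∀ n, tsupport (φ n) ⊆ V) ∧ (∀ n x, 0 ≤ φ n x) ∧ ∀ x ∈ V, ∃ n, φ n x ≠ 0 := by
  let ι := {f : E → ℝ // ContDiff ℝ k f ∧ HasCompactSupport f ∧ tsupport f ⊆ V ∧ ∀ x, 0 ≤ f x}
  let z : ι := ⟨fun _ => 0, contDiff_const, HasCompactSupport.zero,
    by simp [tsupport], fun _ => le_rfl⟩
  obtain ⟨T, T_count, hT⟩ := TopologicalSpace.isOpen_iUnion_countable (fun f : ι => Function.support f.1)
    fun f => f.2.1.continuous.isOpen_support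
  obtain ⟨g, hg⟩ := (T_count.insert z).exists_eq_range (insert_nonempty z T)
  refine ⟨fun n => (g n).1, fun n => (g n).2.1, fun n => (g n).2.2.1, fun n => (g n).2.2.2.1,
    fun n => (g n).2.2.2.2, fun x hx => ?_⟩
  obtain ⟨f, hfV, hfc, hf, hf01, hfx⟩ := exists_contDiff_tsupport_subset (n := k) (hV.mem_nhds hx)
  have hxT : x ∈ ⋃ f ∈ T, Function.support f.1 := by
    rw [hT]
    exact mem_iUnion_of_mem
      (⟨f, hf, hfc, hfV, fun y => (hf01 (mem_range_self y)).1⟩ : ι) (by simp [hfx])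
  obtain ⟨i, hiT, hi⟩ := mem_iUnion₂.1 hxT
  obtain ⟨n, rfl⟩ : i ∈ range g := hg ▸ mem_insert_of_mem z hiT
  exact ⟨n, hi⟩

/-- A function which is `C^k` on an open set `V` becomes `C^k` everywhere after multiplication by
a suitable `C^k` function without zeros on `V`. -/
theorem ContDiffOn.exists_contDiff_mul {E : Type*} [NormedAddCommGroup E] [NormedSpace ℝ E]
    [FiniteDimensional ℝ E] {k : ℕ∞} {V : Set E} {h : E → ℝ} (hh : ContDiffOn ℝ k h V)
    (hV : IsOpen V) :
    ∃ a : E → ℝ, ContDiff ℝ k a ∧ ContDiff ℝ k (fun x => a x * h x) ∧ ∀ x ∈ V, a x ≠ 0 := by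
  obtain ⟨φ, hφ, hφc, hφV, hφ0, hφx⟩ := hV.exists_seq_contDiff_cover k
  have hφh : ∀ n, ContDiff ℝ k fun x => φ n x * h x := by
    refine fun n => contDiff_iff_contDiffAt.2 fun x => ?_
    by_cases hx : x ∈ tsupport (φ n)
    · exact (hφ n).contDiffAt.mul (hh.contDiffAt (hV.mem_nhds (hφV n hx)))
    · refine (contDiffAt_const (c := (0 : ℝ))).congr_of_eventuallyEq ?_
      filter_upwards [(isClosed_tsupport (φ n)).isOpen_compl.mem_nhds hx] with y hy
      rw [image_eq_zero_of_notMem_tsupport hy, zero_mul]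
  obtain ⟨r, rpos, hr, hs⟩ := exists_pos_contDiff_tsum_smul
    (u := fun n x => (φ n x, φ n x * h x)) (fun n => (hφ n).prodMk (hφh n)) (fun n => by
      refine (hφc n).mono fun x hx => ?_
      contrapose! hx
      simp_all)
  have hs₁ : ∀ x, HasSum (fun n => r n * φ n x) (∑' n, r n • (φ n x, φ n x * h x)).1 := fun x =>
    (hs x).hasSum.mapL (ContinuousLinearMap.fst ℝ ℝ ℝ)
  have hs₂ : ∀ x, HasSum (fun n => r n * (φ n x * h x)) (∑' n, r n • (φ n x, φ n x * h x)).2 :=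
    fun x => (hs x).hasSum.mapL (ContinuousLinearMap.snd ℝ ℝ ℝ)
  refine ⟨fun x => (∑' n, r n • (φ n x, φ n x * h x)).1, contDiff_fst.comp hr, ?_, fun x hx => ?_⟩
  · convert contDiff_snd.comp hr using 1
    funext x
    refine ((hs₁ x).mul_right (h x)).unique ?_
    simp only [mul_assoc]
    exact hs₂ x
  · obtain ⟨n, hn⟩ := hφx x hx
    beta_reduce
    rw [← (hs₁ x).tsum_eq]
    exact ((hs₁ x).summable.tsum_pos (fun i => mul_nonneg (rpos i).le (hφ0 i x)) n
      (mul_pos (rpos n) ((hφ0 n x).lt_of_ne' hn))).ne'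

theorem Ck.contDiff {k : ℕ∞} (f : Ck k) : ContDiff ℝ k f.1 :=
  f.2

/-- A function in `C^k(ℝ)` without zeros on a dense set is not a zero divisor. -/
theorem Ck.mem_nonZeroDivisors_of_dense {k : ℕ∞} {V : Set ℝ} (hV : Dense V) {a : Ck k}
    (ha : ∀ x ∈ V, a.1 x ≠ 0) : a ∈ (Ck k)⁰ := by
  refine mem_nonZeroDivisors_iff_right.2 fun g hg => Subtype.ext ?_
  refine Continuous.ext_on hV (Ck.contDiff g).continuous continuous_const fun x hx => ?_
  have : g.1 x * a.1 x = 0 := congrFun (congrArg Subtype.val hg) x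
  exact (mul_eq_zero.1 this).resolve_right (ha x hx)

/-- Compatible partial quotients `b / f` in `C^k(ℝ)` are all given by a single fraction `c / a`. -/
theorem Ck.exists_common_fraction {k : ℕ∞} {S : Set (Ck k × Ck k)}
    (hS : ∀ p ∈ S, ∀ q ∈ S, p.1 * q.2 = q.1 * p.2)
    (hS₀ : ∀ p ∈ S, ∀ e, e * p.1 = 0 → e * p.2 = 0) :
    ∃ a ∈ (Ck k)⁰, ∃ c, ∀ p ∈ S, a * p.2 = c * p.1 := by
  classical
  let U : Set ℝ := {x | ∃ p ∈ S, p.1.1 x ≠ 0}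
  let V : Set ℝ := U ∪ (closure U)ᶜ
  have hcoz : ∀ f : Ck k, IsOpen {x | f.1 x ≠ 0} := fun f =>
    (Ck.contDiff f).continuous.isOpen_support
  have hU : IsOpen U := by
    have : U = ⋃ p ∈ S, {x | p.1.1 x ≠ 0} := by ext; simp [U]
    rw [this]
    exact isOpen_biUnion fun p _ => hcoz p.1
  have hV : IsOpen V := hU.union isClosed_closure.isOpen_compl
  have hVd : Dense V := fun x => by
    by_cases hx : x ∈ closure U
    · exact closure_mono subset_union_left hx
    · exact subset_closure (Or.inr hx)
  let h : ℝ → ℝ := fun x => if hx : x ∈ U then hx.choose.2.1 x / hx.choose.1.1 x else 0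
  have h_mul : ∀ p ∈ S, ∀ x ∈ U, h x * p.1.1 x = p.2.1 x := by
    intro p hp x hx
    have hq := hx.choose_spec
    have : hx.choose.1.1 x * p.2.1 x = p.1.1 x * hx.choose.2.1 x :=
      congrFun (congrArg Subtype.val (hS _ hq.1 _ hp)) x
    have hne := hq.2
    simp only [h, dif_pos hx]
    rw [div_mul_eq_mul_div, div_eq_iff hne]
    linarith
  have h_zero : ∀ x ∉ U, h x = 0 := fun x hx => dif_neg hx
  have hh : ContDiffOn ℝ k h V := by
    intro x hx
    refine ContDiffAt.contDiffWithinAt ?_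
    rcases hx with ⟨p, hp, hpx⟩ | hx
    · refine (ContDiffAt.div (Ck.contDiff p.2).contDiffAt (Ck.contDiff p.1).contDiffAt
        hpx).congr_of_eventuallyEq ?_
      filter_upwards [(hcoz p.1).mem_nhds hpx] with y hy
      exact (eq_div_iff hy).2 (h_mul p hp y ⟨p, hp, hy⟩)
    · refine (contDiffAt_const (c := (0 : ℝ))).congr_of_eventuallyEq ?_
      filter_upwards [isClosed_closure.isOpen_compl.mem_nhds hx] with y hy
      exact h_zero y fun hyU => hy (subset_closure hyU)
  obtain ⟨a, ha, hah, haV⟩ := hh.exists_contDiff_mul hV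
  obtain ⟨e, hesupp, he, -⟩ :=
    (isClosed_closure (s := U)).isOpen_compl.exists_contDiff_support_eq (n := k)
  refine ⟨⟨a, ha⟩, Ck.mem_nonZeroDivisors_of_dense hVd haV, ⟨_, hah⟩, fun p hp => Subtype.ext ?_⟩
  refine Continuous.ext_on hVd (ha.continuous.mul (Ck.contDiff p.2).continuous)
    (hah.continuous.mul (Ck.contDiff p.1).continuous) fun x hx => ?_
  change a x * p.2.1 x = a x * h x * p.1.1 x
  rcases hx with hx | hx
  · rw [mul_assoc, h_mul p hp x hx]
  · have hp0 : ∀ y ∉ U, p.1.1 y = 0 := fun y hy => by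
      by_contra hne
      exact hy ⟨p, hp, hne⟩
    have hep : (⟨e, he⟩ : Ck k) * p.1 = 0 := Subtype.ext <| funext fun y => by
      change e y * p.1.1 y = 0
      by_cases hy : y ∈ U
      · have : y ∉ Function.support e := by
          rw [hesupp]
          exact fun hy' => hy' (subset_closure hy)
        rw [Function.notMem_support.1 this, zero_mul]
      · rw [hp0 y hy, mul_zero]
    have hepx : e x * p.2.1 x = 0 := congrFun (congrArg Subtype.val (hS₀ p hp _ hep)) x
    have hex : e x ≠ 0 := by
      rw [← Function.mem_support, hesupp]
      exact hx
    rw [(mul_eq_zero.1 hepx).resolve_left hex, hp0 x fun hxU => hx (subset_closure hxU)]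
    simp

/-- If compatible partial quotients in a commutative ring `R` are always given by a single fraction,
then the total ring of fractions of `R` is self-injective. -/
theorem FractionRing.injective_self_of_exists_common_fraction {R : Type*} [CommRing R]
    (H : ∀ S : Set (R × R), (∀ p ∈ S, ∀ q ∈ S, p.1 * q.2 = q.1 * p.2) →
      (∀ p ∈ S, ∀ e, e * p.1 = 0 → e * p.2 = 0) → ∃ a ∈ R⁰, ∃ c, ∀ p ∈ S, a * p.2 = c * p.1) :
    Module.Injective (FractionRing R) (FractionRing R) := by
  refine Module.Baer.injective fun I g => ?_
  let ψ := algebraMap R (FractionRing R)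
  have hψ : Function.Injective ψ := IsFractionRing.injective R (FractionRing R)
  obtain ⟨a, ha, c, hac⟩ := H {p | ∃ hp : ψ p.1 ∈ I, g ⟨ψ p.1, hp⟩ = ψ p.2} (by
    rintro ⟨f₁, b₁⟩ ⟨h₁, e₁⟩ ⟨f₂, b₂⟩ ⟨h₂, e₂⟩
    refine hψ ?_
    simp only [map_mul]
    rw [← e₁, ← e₂, ← smul_eq_mul, ← smul_eq_mul, ← map_smul, ← map_smul]
    exact congrArg g (Subtype.ext (mul_comm _ _))) (by
    rintro ⟨f, b⟩ ⟨h, e⟩ r hr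
    refine hψ ?_
    rw [map_mul, ← e, ← smul_eq_mul, ← map_smul, map_zero, ← map_zero g]
    refine congrArg g (Subtype.ext ?_)
    change ψ r * ψ f = 0
    rw [← map_mul, hr, map_zero])
  refine ⟨LinearMap.mulLeft _ (IsLocalization.mk' _ c ⟨a, ha⟩), fun x hx => ?_⟩
  obtain ⟨⟨r, s⟩, hrs⟩ := IsLocalization.surj R⁰ x
  obtain ⟨⟨b, t⟩, hbt⟩ := IsLocalization.surj R⁰ (g ⟨x, hx⟩)
  have hrt : ψ (r * t) = ψ (s * t) * x := by
    simp only [map_mul, ψ]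
    rw [← hrs]
    ring
  have hmem : ψ (r * t) ∈ I := hrt ▸ I.mul_mem_left _ hx
  have hg : g ⟨ψ (r * t), hmem⟩ = ψ (s * t) * g ⟨x, hx⟩ := by
    rw [← smul_eq_mul (ψ (s * t)), ← map_smul]
    exact congrArg g (Subtype.ext hrt)
  have key := congrArg ψ (hac (r * t, s * b) ⟨hmem, hg.trans (by
    simp only [map_mul, ψ]
    rw [← hbt]
    ring)⟩)
  have hu : IsUnit (ψ (s * t)) := IsLocalization.map_units (FractionRing R) (s * t)
  have hua : IsUnit (ψ a) := IsLocalization.map_units (FractionRing R) (⟨a, ha⟩ : R⁰)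
  refine hua.mul_left_cancel (hu.mul_left_cancel ?_)
  have hmk : ψ a * IsLocalization.mk' (FractionRing R) c (⟨a, ha⟩ : R⁰) = ψ c :=
    IsLocalization.mk'_spec' _ c (⟨a, ha⟩ : R⁰)
  rw [LinearMap.mulLeft_apply, ← mul_assoc (ψ a), hmk, mul_left_comm, ← hrt, ← map_mul, ← key]
  simp only [map_mul, ψ]
  rw [← hbt]
  ring

/-- The classical ring of quotients of `C^k(ℝ)` is self-injective: it is
injective as a module over itself. -/
theorem stmt11 (k : ℕ∞) :
    Module.Injective (FractionRing (Ck k)) (FractionRing (Ck k)) :=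
  FractionRing.injective_self_of_exists_common_fraction fun _ => Ck.exists_common_fraction
end
end

section
/- Fix k ∈ ℕ ∪ {∞} and let U be a nonempty open subset of ℝ. The classical ring of quotients of C^k(U), i.e., the localization of C^k(U) at its submonoid of non-zero-divisors, is von Neumann regular: for every q in this localization there exists t with q·t·q = q. -/
noncomputable section

/-- If every element `a` of a commutative ring admits `g` with `a * g = 0` and `a + g` a
non-zero-divisor, then the total ring of fractions is von Neumann regular. -/
theorem FractionRing.exists_mul_mul_self_eq {R : Type*} [CommRing R]
    (h : ∀ a : R, ∃ g : R, a * g = 0 ∧ a + g ∈ nonZeroDivisors R) (q : FractionRing R) :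
    ∃ t : FractionRing R, q * t * q = q := by
  obtain ⟨a, s, rfl⟩ := IsLocalization.exists_mk'_eq (nonZeroDivisors R) q
  obtain ⟨g, hg, hmem⟩ := h a
  refine ⟨IsLocalization.mk' _ (s : R) ⟨a + g, hmem⟩, ?_⟩
  rw [← IsLocalization.mk'_mul, ← IsLocalization.mk'_mul]
  apply IsLocalization.mk'_eq_of_eq
  simp only [Submonoid.coe_mul]
  linear_combination (s : R) * s * hg

/-- An element of `C^k(U)` is continuous. -/
theorem CkOn.continuous {k : ℕ∞} {U : Set ℝ} (f : CkOn k U) : Continuous f.1 := by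
  obtain ⟨F, hF, hFf⟩ := f.2
  have hf : f.1 = U.domRestrict F := funext fun x => (hFf x).symm
  rw [hf]
  exact hF.continuousOn.domRestrict

/-- An element of `C^k(U)` that is nonzero on a dense subset of `U` is a non-zero-divisor. -/
theorem CkOn.mem_nonZeroDivisors_of_dense {k : ℕ∞} {U : Set ℝ} {f : CkOn k U}
    (hf : Dense {x | f.1 x ≠ 0}) : f ∈ nonZeroDivisors (CkOn k U) := by
  rw [mem_nonZeroDivisors_iff_right]
  intro h hfh
  refine Subtype.ext (Continuous.ext_on hf (CkOn.continuous h) continuous_const ?_)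
  intro x hx
  have hx0 : h.1 x * f.1 x = 0 := congrFun (congrArg Subtype.val hfh) x
  exact (mul_eq_zero.mp hx0).resolve_right hx

/-- Every `f` in `C^k(U)` is annihilated by some `g` such that `f + g` is a non-zero-divisor:
take `g` whose cozero set is the interior of the zero set of `f`. -/
theorem CkOn.exists_mul_eq_zero_add_mem_nonZeroDivisors {k : ℕ∞} {U : Set ℝ} (hU : IsOpen U)
    (f : CkOn k U) :
    ∃ g : CkOn k U, f * g = 0 ∧ f + g ∈ nonZeroDivisors (CkOn k U) := by
  obtain ⟨G, hsupp, hG, -⟩ := (hU.isOpenMap_subtype_val _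
    (isOpen_interior (s := {x : U | f.1 x = 0}))).exists_contDiff_support_eq (n := k)
  have hGx (x : U) : G x ≠ 0 ↔ x ∈ interior {x : U | f.1 x = 0} := by
    rw [← Function.mem_support, hsupp, Subtype.val_injective.mem_set_image]
  let g : CkOn k U := ⟨fun x => G x, G, hG.contDiffOn, fun _ => rfl⟩
  have hfG (x : U) (hx : G x ≠ 0) : f.1 x = 0 :=
    interior_subset (s := {x : U | f.1 x = 0}) ((hGx x).mp hx)
  refine ⟨g, ?_, CkOn.mem_nonZeroDivisors_of_dense ?_⟩
  · refine Subtype.ext (funext fun x => show f.1 x * G x = 0 from ?_)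
    by_cases hx : G x = 0
    · rw [hx, mul_zero]
    · rw [hfG x hx, zero_mul]
  · rw [← compl_compl {x | (f + g).1 x ≠ 0}, ← interior_eq_empty_iff_dense_compl,
      Set.eq_empty_iff_forall_notMem]
    intro x hx
    have key (y : U) (hy : y ∈ {x | (f + g).1 x ≠ 0}ᶜ) : f.1 y = 0 ∧ G y = 0 := by
      have hy' : f.1 y + G y = 0 := not_not.mp hy
      by_cases hGy : G y = 0
      · exact ⟨by simpa [hGy] using hy', hGy⟩
      · exact absurd (by simpa [hfG y hGy] using hy') hGy
    exact (hGx x).mpr (interior_mono (fun y hy => (key y hy).1) hx) (key x (interior_subset hx)).2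

/-- For nonempty open `U ⊆ ℝ`, the classical ring of quotients of `C^k(U)`
is von Neumann regular. -/
theorem stmt12 (k : ℕ∞) (U : Set ℝ) (hU : IsOpen U) (hUne : U.Nonempty) :
    ∀ q : FractionRing (CkOn k U), ∃ t : FractionRing (CkOn k U), q * t * q = q := by
  exact FractionRing.exists_mul_mul_self_eq
    (CkOn.exists_mul_eq_zero_add_mem_nonZeroDivisors hU)
end
end

section
/- Let k ∈ ℕ and let l ∈ ℕ ∪ {∞} with k < l. Then there exists a function f : ℝ → ℝ that is C^k on ℝ, such that for all functions g, h : ℝ → ℝ that are C^l on ℝ with coz g dense in ℝ, it is NOT the case that f(x)·g(x) = h(x) for all x ∈ coz g. (Consequently the classical ring of quotients of C^k(ℝ) strictly contains that of C^l(ℝ).) -/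
noncomputable section

open Filter Topology

/-- Every continuous function is the `k`-th derivative of a `C^k` function. -/
theorem exists_contDiff_iteratedDeriv_eq (k : ℕ) {φ : ℝ → ℝ} (hφ : Continuous φ) :
    ∃ f : ℝ → ℝ, ContDiff ℝ k f ∧ iteratedDeriv k f = φ := by
  induction k with
  | zero => exact ⟨φ, by simpa using hφ, by simp⟩
  | succ k ih =>
    obtain ⟨f, hf, hfφ⟩ := ih
    have hd (x : ℝ) : HasDerivAt (fun u => ∫ t in (0 : ℝ)..u, f t) (f x) x :=
      intervalIntegral.integral_hasDerivAt_right (hf.continuous.intervalIntegrable _ _)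
        (hf.continuous.stronglyMeasurableAtFilter _ _) hf.continuous.continuousAt
    have hderiv : deriv (fun u => ∫ t in (0 : ℝ)..u, f t) = f := funext fun x => (hd x).deriv
    refine ⟨fun u => ∫ t in (0 : ℝ)..u, f t, ?_, ?_⟩
    · push_cast
      rw [contDiff_succ_iff_deriv, hderiv]
      exact ⟨fun x => (hd x).differentiableAt, by simp, hf⟩
    · rw [iteratedDeriv_succ', hderiv, hfφ]

/-- A function whose symmetric second difference at `a` is at least `c * t` for all `t > 0`,
with `c > 0`, is not differentiable at `a`. -/
theorem not_differentiableAt_of_mul_le_second_difference {φ : ℝ → ℝ} {a c : ℝ} (hc : 0 < c)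
    (h : ∀ t > 0, c * t ≤ φ (a + t) + φ (a - t) - 2 * φ a) : ¬ DifferentiableAt ℝ φ a := by
  intro hd
  have hp : HasDerivAt (fun t => φ (a + t)) (deriv φ a) 0 := by
    apply HasDerivAt.comp_const_add
    simpa using hd.hasDerivAt
  have hm : HasDerivAt (fun t => φ (a - t)) (-deriv φ a) 0 := by
    apply HasDerivAt.comp_const_sub
    simpa using hd.hasDerivAt
  have hs := (hp.add hm).tendsto_slope_zero_right
  rw [add_neg_cancel] at hs
  refine hc.not_ge (ge_of_tendsto hs ?_)
  filter_upwards [self_mem_nhdsWithin] with t ht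
  have ht : 0 < t := ht
  have := h t ht
  simp only [Pi.add_apply, zero_add, add_zero, sub_zero, smul_eq_mul]
  rw [inv_mul_eq_div, le_div_iff₀ ht]
  linarith

/-- There is a continuous function on `ℝ` that fails to be differentiable at the points of a
countable dense set. -/
theorem exists_continuous_not_differentiableAt_dense :
    ∃ φ : ℝ → ℝ, Continuous φ ∧ ∃ q : ℕ → ℝ, DenseRange q ∧ ∀ n, ¬ DifferentiableAt ℝ φ (q n) := by
  obtain ⟨q, hq⟩ := TopologicalSpace.exists_dense_seq ℝ
  let c : ℕ → ℝ := fun n => (1 / 2) ^ n / (1 + |q n|)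
  have hc (n : ℕ) : 0 < c n := by positivity
  have hgeom : Summable fun n : ℕ => ((1 : ℝ) / 2) ^ n := summable_geometric_two
  have hcs : Summable c := by
    refine hgeom.of_nonneg_of_le (fun n => (hc n).le) fun n => ?_
    exact div_le_self (by positivity) (by linarith [abs_nonneg (q n)])
  have hs (x : ℝ) : Summable fun n => c n * |x - q n| := by
    refine (hgeom.mul_right (1 + |x|)).of_nonneg_of_le
      (fun n => mul_nonneg (hc n).le (abs_nonneg _)) fun n => ?_
    have h1 : |x - q n| ≤ (1 + |q n|) * (1 + |x|) := by
      nlinarith [abs_sub x (q n), abs_nonneg x, abs_nonneg (q n),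
        mul_nonneg (abs_nonneg x) (abs_nonneg (q n))]
    calc c n * |x - q n| ≤ c n * ((1 + |q n|) * (1 + |x|)) := by gcongr
      _ = (1 / 2) ^ n * (1 + |x|) := by
        have : 1 + |q n| ≠ 0 := by positivity
        simp only [c]
        field_simp
  refine ⟨fun x => ∑' n, c n * |x - q n|, ?_, q, hq, fun m => ?_⟩
  · refine (LipschitzWith.of_le_add_mul' (∑' n, c n) fun x y => ?_).continuous
    rw [← tsum_mul_right, ← (hs y).tsum_add (hcs.mul_right _)]
    refine (hs x).tsum_le_tsum (fun n => ?_) ((hs y).add (hcs.mul_right _))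
    rw [← mul_add, Real.dist_eq]
    gcongr
    linarith [abs_sub_le x y (q n)]
  · refine not_differentiableAt_of_mul_le_second_difference (c := 2 * c m)
      (by linarith [hc m]) fun t ht => ?_
    have hsum := ((hs (q m + t)).add (hs (q m - t))).sub ((hs (q m)).mul_left 2)
    rw [← (hs _).tsum_add (hs _), ← tsum_mul_left,
      ← ((hs _).add (hs _)).tsum_sub ((hs _).mul_left 2)]
    refine le_trans (le_of_eq ?_) (hsum.le_tsum m fun n _ => ?_)
    · simp [abs_of_pos ht]
      ring
    · have h1 := abs_add_le (q m + t - q n) (q m - t - q n)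
      rw [show q m + t - q n + (q m - t - q n) = 2 * (q m - q n) by ring, abs_mul, abs_two] at h1
      nlinarith [hc n]

/-- For `k ∈ ℕ` and `l ∈ ℕ ∪ {∞}` with `k < l`, there is a `C^k` function `f`
which is not expressible as `h/g` with `g, h` of class `C^l` and `coz g` dense;
hence `Q_cl(C^k(ℝ)) ≠ Q_cl(C^l(ℝ))`. -/
theorem stmt13 (k : ℕ) (l : ℕ∞) (hkl : (k : ℕ∞) < l) :
    ∃ f : ℝ → ℝ, ContDiff ℝ k f ∧
      ∀ g h : ℝ → ℝ, ContDiff ℝ l g → ContDiff ℝ l h → Dense (coz g) →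
        ¬ (∀ x ∈ coz g, f x * g x = h x) := by
  obtain ⟨φ, hφ, q, hq, hnd⟩ := exists_continuous_not_differentiableAt_dense
  obtain ⟨f, hf, hfφ⟩ := exists_contDiff_iteratedDeriv_eq k hφ
  refine ⟨f, hf, fun g h hg hh hdense hfg => ?_⟩
  have hopen : IsOpen (coz g) := isOpen_ne_fun hg.continuous continuous_const
  obtain ⟨n, hn⟩ := hq.exists_mem_open hopen hdense.nonempty
  have hquot : f =ᶠ[𝓝 (q n)] fun x => h x / g x := by
    filter_upwards [hopen.mem_nhds hn] with x hx
    rw [← hfg x hx, mul_div_cancel_right₀ _ hx]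
  have hfl : ContDiffAt ℝ l f (q n) :=
    (hh.contDiffAt.div hg.contDiffAt hn).congr_of_eventuallyEq hquot
  apply hnd n
  rw [← hfφ]
  rw [iteratedDeriv_eq_equiv_comp]
  exact (LinearIsometryEquiv.differentiableAt _).comp _
    (hfl.differentiableAt_iteratedFDeriv (by exact_mod_cast hkl))
end
end

section
/- Let k ∈ ℕ and let l ∈ ℕ ∪ {∞} with k ≤ l. If g : ℝ → ℝ is C^l on ℝ and g is a non-zero-divisor in the ring C^l(ℝ), then g is C^k on ℝ and g is a non-zero-divisor in the ring C^k(ℝ). -/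
noncomputable section

/-- For `k ∈ ℕ`, `l ∈ ℕ ∪ {∞}` with `k ≤ l`: a non-zero-divisor of `C^l(ℝ)`
is `C^k` and is a non-zero-divisor of `C^k(ℝ)`. -/
theorem stmt14 (k : ℕ) (l : ℕ∞) (hkl : (k : ℕ∞) ≤ l) (g : ℝ → ℝ)
    (hg : ContDiff ℝ l g)
    (hnzd : ∀ f : ℝ → ℝ, ContDiff ℝ l f → (∀ x, f x * g x = 0) → f = 0) :
    ContDiff ℝ k g ∧
      ∀ f : ℝ → ℝ, ContDiff ℝ k f → (∀ x, f x * g x = 0) → f = 0 := by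
  refine ⟨hg.of_le (by exact_mod_cast hkl), fun f hf hfg => ?_⟩
  by_contra hne
  obtain ⟨a, ha⟩ := Function.ne_iff.mp hne
  have hs : {x | f x ≠ 0} ∈ nhds a :=
    (isOpen_ne_fun hf.continuous continuous_const).mem_nhds ha
  obtain ⟨φ, hsupp, -, hφ, -, hφa⟩ := exists_contDiff_tsupport_subset (n := l) hs
  have hφ0 : φ = 0 := hnzd φ hφ fun x => by
    by_cases hx : φ x = 0
    · simp [hx]
    · have hfx : f x ≠ 0 := hsupp (subset_tsupport φ hx)
      simp [(mul_eq_zero.mp (hfg x)).resolve_left hfx]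
  simp [hφ0] at hφa
end
end

section
/- Fix k ∈ ℕ ∪ {∞}. Let f : ℝ → ℝ be continuous, and suppose there is a dense open set V ⊆ ℝ such that f restricted to V is C^k on V (ContDiffOn ℝ k f V). Then there exist g, h : ℝ → ℝ, both C^k on ℝ, such that coz g = V (in particular coz g is dense, so g is a non-zero-divisor in C^k(ℝ)) and f(x)·g(x) = h(x) for every x ∈ ℝ. (Hence every such f lies in the classical ring of quotients of C^k(ℝ).) -/
noncomputable section

open Set Function Filter
open scoped ContDiff

section

variable {E : Type*} [NormedAddCommGroup E] [NormedSpace ℝ E]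

/-- A product is `C^k` everywhere if one factor is and its topological support lies in an open set
on which the other factor is `C^k`. -/
lemma ContDiffOn.contDiff_mul_of_tsupport_subset {k : ℕ∞} {f g : E → ℝ} {V : Set E}
    (hV : IsOpen V) (hf : ContDiffOn ℝ k f V) (hg : ContDiff ℝ k g) (hgV : tsupport g ⊆ V) :
    ContDiff ℝ k (fun x ↦ f x * g x) := by
  refine contDiff_of_contDiffOn_union_of_isOpen (s := V) (t := (tsupport g)ᶜ)
    (hf.mul hg.contDiffOn) ?_ ?_ hV (isClosed_tsupport g).isOpen_compl
  · exact contDiffOn_const (c := (0 : ℝ)) |>.congr fun x hx ↦ by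
      rw [image_eq_zero_of_notMem_tsupport hx, mul_zero]
  · refine eq_univ_of_forall fun x ↦ ?_
    by_cases hx : x ∈ tsupport g
    · exact Or.inl (hgV hx)
    · exact Or.inr hx

/-- The derivatives up to a finite order of a compactly supported `C^k` function are uniformly
bounded. -/
lemma ContDiff.eventually_norm_iteratedFDeriv_le {k : ℕ∞} {u : E → ℝ}
    (hu : ContDiff ℝ k u) (hc : HasCompactSupport u) (n : ℕ) :
    ∀ᶠ M : ℝ in atTop, ∀ i ∈ Finset.range (n + 1), (i : ℕ∞) ≤ k →
      ∀ x, ‖iteratedFDeriv ℝ i u x‖ ≤ M := by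
  rw [eventually_all_finset]
  intro i _
  by_cases hik : (i : ℕ∞) ≤ k
  · obtain ⟨R, hR⟩ := (hu.continuous_iteratedFDeriv (m := i)
      (mod_cast hik)).norm.bddAbove_range_of_hasCompactSupport
        ((hc.iteratedFDeriv (𝕜 := ℝ) i).comp_left norm_zero)
    filter_upwards [eventually_ge_atTop R] with M hM _ x
    exact (hR (mem_range_self x)).trans hM
  · exact Eventually.of_forall fun M h ↦ absurd h hik

lemma norm_iteratedFDeriv_const_smul_le {k : ℕ∞} {u : E → ℝ} (hu : ContDiff ℝ k u) {i : ℕ}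
    (hi : (i : ℕ∞) ≤ k) {M c : ℝ} (hM : 0 < M) (hc : 0 ≤ c) {x : E}
    (h : ‖iteratedFDeriv ℝ i u x‖ ≤ M) :
    ‖iteratedFDeriv ℝ i ((M⁻¹ * c) • u) x‖ ≤ c := by
  rw [iteratedFDeriv_const_smul_apply (hu.contDiffAt.of_le (mod_cast hi)), norm_smul,
    Real.norm_of_nonneg (by positivity)]
  calc M⁻¹ * c * ‖iteratedFDeriv ℝ i u x‖ ≤ M⁻¹ * c * M := by gcongr
    _ = c := by field_simp

/-- An open set is a countable union of supports of nonnegative smooth functions whose topological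
supports are compact and contained in it. -/
lemma IsOpen.exists_seq_contDiff_iUnion_support_eq [FiniteDimensional ℝ E] {V : Set E}
    (hV : IsOpen V) (k : ℕ∞) :
    ∃ g : ℕ → E → ℝ, (∀ n, tsupport (g n) ⊆ V) ∧ (∀ n, HasCompactSupport (g n)) ∧
      (∀ n, ContDiff ℝ k (g n)) ∧ (∀ n x, 0 ≤ g n x) ∧ ⋃ n, support (g n) = V := by
  let ι := {f : E → ℝ // tsupport f ⊆ V ∧ HasCompactSupport f ∧ ContDiff ℝ k f ∧ ∀ x, 0 ≤ f x}
  have cover : ⋃ f : ι, support (f : E → ℝ) = V := by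
    refine Subset.antisymm (iUnion_subset fun f ↦ (subset_tsupport _).trans f.2.1) fun x hx ↦ ?_
    obtain ⟨f, hfV, hfc, hf, hf01, hfx⟩ :=
      exists_contDiff_tsupport_subset (n := k) (hV.mem_nhds hx)
    exact mem_iUnion.2 ⟨⟨f, hfV, hfc, hf, fun y ↦ (hf01 (mem_range_self y)).1⟩, by simp [hfx]⟩
  obtain ⟨T, hTc, hT⟩ := TopologicalSpace.isOpen_iUnion_countable
    (fun f : ι ↦ support (f : E → ℝ)) fun f ↦ f.2.2.2.1.continuous.isOpen_support
  let z : ι := ⟨0, by simp [tsupport], HasCompactSupport.zero, contDiff_const, fun _ ↦ le_rfl⟩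
  obtain ⟨g, hg⟩ := (hTc.insert z).exists_eq_range (insert_nonempty z T)
  refine ⟨fun n ↦ (g n).1, fun n ↦ (g n).2.1, fun n ↦ (g n).2.2.1, fun n ↦ (g n).2.2.2.1,
    fun n ↦ (g n).2.2.2.2, Subset.antisymm
      (iUnion_subset fun n ↦ (subset_tsupport _).trans (g n).2.1) fun x hx ↦ ?_⟩
  rw [← cover, ← hT] at hx
  obtain ⟨f, hfT, hfx⟩ := mem_iUnion₂.1 hx
  obtain ⟨n, rfl⟩ : f ∈ range g := hg ▸ mem_insert_of_mem z hfT
  exact mem_iUnion.2 ⟨n, hfx⟩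

/-- If `f` is `C^k` on an open set `V`, then there is a `C^k` function `g` with support `V` such
that `f * g` is `C^k` everywhere. -/
theorem ContDiffOn.exists_contDiff_support_eq_mul [FiniteDimensional ℝ E] {k : ℕ∞} {f : E → ℝ}
    {V : Set E} (hV : IsOpen V) (hf : ContDiffOn ℝ k f V) :
    ∃ g : E → ℝ, support g = V ∧ ContDiff ℝ k g ∧ ContDiff ℝ k (fun x ↦ f x * g x) := by
  obtain ⟨g, hgV, hgc, hg, hg0, hgU⟩ := hV.exists_seq_contDiff_iUnion_support_eq k
  have hfg n : ContDiff ℝ k (fun x ↦ f x * g n x) :=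
    hf.contDiff_mul_of_tsupport_subset hV (hg n) (hgV n)
  have hfgc n : HasCompactSupport (fun x ↦ f x * g n x) := (hgc n).mul_left
  have bound n := (((hg n).eventually_norm_iteratedFDeriv_le (hgc n) n).and
    ((hfg n).eventually_norm_iteratedFDeriv_le (hfgc n) n)).and (eventually_gt_atTop 0) |>.exists
  choose M hM hMpos using bound
  let r : ℕ → ℝ := fun n ↦ (M n)⁻¹ * (1 / 2) ^ n
  have rpos n : 0 < r n := mul_pos (inv_pos.2 (hMpos n)) (by positivity)
  have smooth_tsum (u : ℕ → E → ℝ) (hu : ∀ n, ContDiff ℝ k (u n))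
      (hb : ∀ n, ∀ i ∈ Finset.range (n + 1), (i : ℕ∞) ≤ k →
        ∀ x, ‖iteratedFDeriv ℝ i (u n) x‖ ≤ M n) :
      ContDiff ℝ k (fun x ↦ ∑' n, (r n • u n) x) := by
    refine contDiff_tsum_of_eventually (fun n ↦ (hu n).const_smul (r n))
      (fun _ _ ↦ summable_geometric_two) fun i hi ↦ ?_
    rw [Nat.cofinite_eq_atTop]
    filter_upwards [eventually_ge_atTop i] with n hn x
    exact norm_iteratedFDeriv_const_smul_le (hu n) (mod_cast hi) (hMpos n) (by positivity)
      (hb n i (Finset.mem_range_succ_iff.2 hn) (mod_cast hi) x)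
  have S x : Summable fun n ↦ (r n • g n) x := by
    refine .of_norm_bounded summable_geometric_two fun n ↦ ?_
    rw [← norm_iteratedFDeriv_zero (𝕜 := ℝ) (f := r n • g n)]
    exact norm_iteratedFDeriv_const_smul_le (hg n) (by simp) (hMpos n) (by positivity)
      ((hM n).1 0 (by simp) (by simp) x)
  refine ⟨fun x ↦ ∑' n, (r n • g n) x, ?_, smooth_tsum g hg fun n ↦ (hM n).1, ?_⟩
  · ext x
    rw [← hgU, mem_iUnion, mem_support]
    constructor
    · contrapose!
      intro hx
      have hx n : g n x = 0 := notMem_support.1 (hx n)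
      simp [hx]
    · rintro ⟨n, hn⟩
      exact ((S x).tsum_pos (fun i ↦ mul_nonneg (rpos i).le (hg0 i x)) n
        (mul_pos (rpos n) ((hg0 n x).lt_of_ne' hn))).ne'
  · convert! smooth_tsum _ hfg fun n ↦ (hM n).2 using 2 with x
    rw [← tsum_mul_left]
    exact tsum_congr fun n ↦ mul_left_comm _ _ _

end

/-- If a continuous `f : ℝ → ℝ` is `C^k` on some dense open `V ⊆ ℝ`, then there
are `g, h` of class `C^k` on `ℝ` with `coz g = V` and `f * g = h` everywhere;
hence `f` lies in the classical ring of quotients of `C^k(ℝ)`. -/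
theorem stmt15 (k : ℕ∞) (f : ℝ → ℝ) (hf : Continuous f) (V : Set ℝ)
    (hV : IsOpen V) (hVd : Dense V) (hfV : ContDiffOn ℝ k f V) :
    ∃ g h : ℝ → ℝ, ContDiff ℝ k g ∧ ContDiff ℝ k h ∧ coz g = V ∧
      ∀ x, f x * g x = h x := by
  obtain ⟨g, hgV, hg, hfg⟩ := hfV.exists_contDiff_support_eq_mul hV
  exact ⟨g, fun x ↦ f x * g x, hg, hfg, hgV, fun _ ↦ rfl⟩
end
end
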